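/- If (φ₀,φ₁) ≢ 0, then the set D₁ = {(σ,θ) ∈ (−∞,M)×[0,2π] : F₁(σ,θ) ≠ 0 and F₂(σ,θ) ≠ 0} is nonempty. -/

import Mathlib

open Real MeasureTheory Filter Topology Asymptotics

noncomputable section

/-- Partial derivative in the `i`-th coordinate direction on `Fin 3 → ℝ`
(coordinates `y = (t, x₁, x₂)`). -/
def pd (i : Fin 3) (f : (Fin 3 → ℝ) → ℝ) : (Fin 3 → ℝ) → ℝ :=
  fun y => fderiv ℝ f y (Pi.single i 1)

/-- Radon transform of `v : ℝ² → ℝ` over the line `x · ω = s`, where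
`ω = (cos θ, sin θ)`. -/
def radon (v : ℝ × ℝ → ℝ) (s θ : ℝ) : ℝ :=
  ∫ t : ℝ, v (s * Real.cos θ - t * Real.sin θ, s * Real.sin θ + t * Real.cos θ)

/-- `ω̂ = (-1, cos θ, sin θ)`. -/
def omegaHat (θ : ℝ) : Fin 3 → ℝ := ![(-1 : ℝ), Real.cos θ, Real.sin θ]

/-- The Friedlander radiation field `F₀` associated with the data `(φ₀, φ₁)`. -/
def F0 (φ0 φ1 : ℝ × ℝ → ℝ) (σ θ : ℝ) : ℝ :=
  (1 / (2 * Real.pi * Real.sqrt 2)) *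
    ∫ s in Set.Ioi σ,
      (radon φ1 s θ - deriv (fun s' => radon φ0 s' θ) s) / Real.sqrt (s - σ)

/-- `F₁(σ,θ) = (Σ d_ij ω̂_i ω̂_j) ∂_σ F₀(σ,θ)`. -/
def F1 (d : Fin 3 → Fin 3 → ℝ) (φ0 φ1 : ℝ × ℝ → ℝ) (σ θ : ℝ) : ℝ :=
  (∑ i : Fin 3, ∑ j : Fin 3, d i j * omegaHat θ i * omegaHat θ j) *
    deriv (fun σ' => F0 φ0 φ1 σ' θ) σ

/-- `F₂(σ,θ) = (Σ e_ij^k ω̂_i ω̂_j ω̂_k) ∂²_σ F₀(σ,θ)`. -/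
def F2 (e : Fin 3 → Fin 3 → Fin 3 → ℝ) (φ0 φ1 : ℝ × ℝ → ℝ) (σ θ : ℝ) : ℝ :=
  (∑ i : Fin 3, ∑ j : Fin 3, ∑ k : Fin 3,
      e i j k * omegaHat θ i * omegaHat θ j * omegaHat θ k) *
    deriv (fun σ' => deriv (fun σ'' => F0 φ0 φ1 σ'' θ) σ') σ

/-- `G₀(σ,θ) = (1/F₁) log(1 + F₁/F₂)`. -/
def G0 (d : Fin 3 → Fin 3 → ℝ) (e : Fin 3 → Fin 3 → Fin 3 → ℝ)
    (φ0 φ1 : ℝ × ℝ → ℝ) (σ θ : ℝ) : ℝ :=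
  (1 / F1 d φ0 φ1 σ θ) * Real.log (1 + F1 d φ0 φ1 σ θ / F2 e φ0 φ1 σ θ)

/-- The set `A`. -/
def setA (M : ℝ) (d : Fin 3 → Fin 3 → ℝ) (e : Fin 3 → Fin 3 → Fin 3 → ℝ)
    (φ0 φ1 : ℝ × ℝ → ℝ) : Set (ℝ × ℝ) :=
  {p | p.1 < M ∧ p.2 ∈ Set.Icc 0 (2 * Real.pi) ∧
    F1 d φ0 φ1 p.1 p.2 ≠ 0 ∧ F2 e φ0 φ1 p.1 p.2 ≠ 0 ∧
    0 < 1 + F1 d φ0 φ1 p.1 p.2 / F2 e φ0 φ1 p.1 p.2}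

/-- The set `B = {(σ,θ) ∈ A : G₀(σ,θ) > 0}`. -/
def setB (M : ℝ) (d : Fin 3 → Fin 3 → ℝ) (e : Fin 3 → Fin 3 → Fin 3 → ℝ)
    (φ0 φ1 : ℝ × ℝ → ℝ) : Set (ℝ × ℝ) :=
  {p ∈ setA M d e φ0 φ1 | 0 < G0 d e φ0 φ1 p.1 p.2}

/-- `τ₀ = inf_{(σ,θ) ∈ B} G₀(σ,θ)`. -/
def tau0 (M : ℝ) (d : Fin 3 → Fin 3 → ℝ) (e : Fin 3 → Fin 3 → Fin 3 → ℝ)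
    (φ0 φ1 : ℝ × ℝ → ℝ) : ℝ :=
  sInf ((fun p : ℝ × ℝ => G0 d e φ0 φ1 p.1 p.2) '' setB M d e φ0 φ1)

/-- The set `D = {(σ,θ) : σ < M, F₁ = 0, F₂ > 0}`. -/
def setD (M : ℝ) (d : Fin 3 → Fin 3 → ℝ) (e : Fin 3 → Fin 3 → Fin 3 → ℝ)
    (φ0 φ1 : ℝ × ℝ → ℝ) : Set (ℝ × ℝ) :=
  {p | p.1 < M ∧ p.2 ∈ Set.Icc 0 (2 * Real.pi) ∧
    F1 d φ0 φ1 p.1 p.2 = 0 ∧ 0 < F2 e φ0 φ1 p.1 p.2}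

/-- `φ` is supported in the closed disk of radius `M` centered at the origin. -/
def SuppIn (M : ℝ) (φ : ℝ × ℝ → ℝ) : Prop :=
  ∀ x : ℝ × ℝ, M ^ 2 < x.1 ^ 2 + x.2 ^ 2 → φ x = 0

/-- The cubic form `Σ e_ij^k ξ_i ξ_j ξ_k` does not satisfy the null condition:
it does not vanish identically on the light cone. -/
def NullCondFails (e : Fin 3 → Fin 3 → Fin 3 → ℝ) : Prop :=
  ∃ ξ : Fin 3 → ℝ, ξ 0 ^ 2 = ξ 1 ^ 2 + ξ 2 ^ 2 ∧ (ξ 1 ≠ 0 ∨ ξ 2 ≠ 0) ∧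
    (∑ i : Fin 3, ∑ j : Fin 3, ∑ k : Fin 3, e i j k * ξ i * ξ j * ξ k) ≠ 0

/-- Hessian (as a 2×2 matrix) of a function of two real variables. -/
def hessCurried (f : ℝ → ℝ → ℝ) (σ θ : ℝ) : Matrix (Fin 2) (Fin 2) ℝ :=
  !![deriv (fun a => deriv (fun b => f b θ) a) σ,
     deriv (fun a => deriv (fun b => f a b) θ) σ;
     deriv (fun b => deriv (fun a => f a b) σ) θ,
     deriv (fun b => deriv (fun b' => f σ b') b) θ]

/-- Minkowski coefficients: `Σ c_ij ∂_ij = ∂_t² - Δ`. -/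
def cMink : Fin 3 → Fin 3 → ℝ := fun i j =>
  if i = j then (if i = 0 then 1 else -1) else 0

/-- `u` is a `C^∞` solution of problem (1.1) on `[0,T) × ℝ²`. -/
def IsSol (g : Fin 3 → Fin 3 → ℝ → (Fin 3 → ℝ) → ℝ) (ε : ℝ)
    (φ0 φ1 : ℝ × ℝ → ℝ) (u : (Fin 3 → ℝ) → ℝ) (T : ℝ) : Prop :=
  ContDiffOn ℝ (⊤ : ℕ∞) u {y | 0 ≤ y 0 ∧ y 0 < T} ∧
  (∀ y : Fin 3 → ℝ, 0 ≤ y 0 → y 0 < T →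
    ∑ i : Fin 3, ∑ j : Fin 3,
      g i j (u y) (fun k => pd k u y) * pd i (pd j u) y = 0) ∧
  (∀ x : ℝ × ℝ, u ![0, x.1, x.2] = ε * φ0 x ∧ pd 0 u ![0, x.1, x.2] = ε * φ1 x)

/-- The lifespan `T_ε`: the supremum of times of existence of smooth solutions. -/
def lifespan (g : Fin 3 → Fin 3 → ℝ → (Fin 3 → ℝ) → ℝ) (ε : ℝ)
    (φ0 φ1 : ℝ × ℝ → ℝ) : ℝ :=
  sSup {T : ℝ | ∃ u, IsSol g ε φ0 φ1 u T}

/-- `V` is a `C^∞` solution of the profile problem (2.1) on `ℝ × S¹ × [0, τmax)`. -/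
def IsProfileSol (M : ℝ) (d : Fin 3 → Fin 3 → ℝ) (e : Fin 3 → Fin 3 → Fin 3 → ℝ)
    (φ0 φ1 : ℝ × ℝ → ℝ) (τmax : ℝ) (V : ℝ → ℝ → ℝ → ℝ) : Prop :=
  ContDiffOn ℝ (⊤ : ℕ∞) (fun p : ℝ × ℝ × ℝ => V p.1 p.2.1 p.2.2)
    {p : ℝ × ℝ × ℝ | 0 ≤ p.2.2 ∧ p.2.2 < τmax} ∧
  (∀ q θ τ : ℝ, V q (θ + 2 * Real.pi) τ = V q θ τ) ∧
  (∀ q θ τ : ℝ, M < q → V q θ τ = 0) ∧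
  (∀ q θ : ℝ, V q θ 0 = F0 φ0 φ1 q θ) ∧
  (∀ q θ τ : ℝ, 0 ≤ τ → τ < τmax →
    deriv (fun τ' => deriv (fun q' => V q' θ τ') q) τ -
      ∑ i : Fin 3, ∑ j : Fin 3,
        (d i j * V q θ τ +
          ∑ k : Fin 3, e i j k * omegaHat θ k * deriv (fun q' => V q' θ τ) q) *
        omegaHat θ i * omegaHat θ j *
        deriv (fun q' => deriv (fun q'' => V q'' θ τ) q') q = 0)

/-- The Jacobian `∂_s q` of the characteristic flow. -/
def kfun (d : Fin 3 → Fin 3 → ℝ) (e : Fin 3 → Fin 3 → Fin 3 → ℝ)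
    (φ0 φ1 : ℝ × ℝ → ℝ) (ρ θ τ : ℝ) : ℝ :=
  if F1 d φ0 φ1 ρ θ = 0 then 1 - τ * F2 e φ0 φ1 ρ θ
  else Real.exp (-τ * F1 d φ0 φ1 ρ θ) * (1 + F2 e φ0 φ1 ρ θ / F1 d φ0 φ1 ρ θ)
        - F2 e φ0 φ1 ρ θ / F1 d φ0 φ1 ρ θ

/-- Partial derivatives on `ℝ × ℝ × ℝ` (coordinates `(s, θ, τ)`). -/
def pd3 : Fin 3 → (ℝ × ℝ × ℝ → ℝ) → ℝ × ℝ × ℝ → ℝ :=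
  ![fun f p => deriv (fun a => f (a, p.2.1, p.2.2)) p.1,
    fun f p => deriv (fun a => f (p.1, a, p.2.2)) p.2.1,
    fun f p => deriv (fun a => f (p.1, p.2.1, a)) p.2.2]

/-- Hessian in the first two variables `(s, θ)` of a function on `ℝ × ℝ × ℝ`. -/
def hessST (f : ℝ × ℝ × ℝ → ℝ) (p : ℝ × ℝ × ℝ) : Matrix (Fin 2) (Fin 2) ℝ :=
  !![pd3 0 (pd3 0 f) p, pd3 0 (pd3 1 f) p;
     pd3 1 (pd3 0 f) p, pd3 1 (pd3 1 f) p]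

/-- The Klainerman vector fields on `ℝ_t × ℝ²`:
`∂_t, ∂_1, ∂_2, S = t∂_t + x₁∂_1 + x₂∂_2, H₁, H₂, R`. -/
def KOp : Fin 7 → ((Fin 3 → ℝ) → ℝ) → (Fin 3 → ℝ) → ℝ :=
  ![fun f => pd 0 f,
    fun f => pd 1 f,
    fun f => pd 2 f,
    fun f y => y 0 * pd 0 f y + y 1 * pd 1 f y + y 2 * pd 2 f y,
    fun f y => y 1 * pd 0 f y + y 0 * pd 1 f y,
    fun f y => y 2 * pd 0 f y + y 0 * pd 2 f y,
    fun f y => y 1 * pd 2 f y - y 2 * pd 1 f y]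

/-- `Z^α`: iterated product of Klainerman vector fields indexed by a list. -/
def Zpow (α : List (Fin 7)) (f : (Fin 3 → ℝ) → ℝ) : (Fin 3 → ℝ) → ℝ :=
  α.foldr (fun i acc => KOp i acc) f

end

lemma sw_lemma {X : Type*} [TopologicalSpace X] [MeasurableSpace X] [BorelSpace X]
    [T2Space X] (μ : Measure X) [IsFiniteMeasureOnCompacts μ] [μ.IsOpenPosMeasure]
    (h : X → ℝ) (hc : Continuous h) (hcs : HasCompactSupport h)
    (S : Submonoid C(X, ℝ))
    (hsep : ∀ x y : X, x ≠ y → ∃ f ∈ S, f x ≠ f y)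
    (hS : ∀ a ∈ S, ∫ x, h x * a x ∂μ = 0) : h = 0 := by
  have hint : ∀ a : C(X, ℝ), Integrable (fun x => h x * a x) μ := fun a =>
    (hc.mul a.continuous).integrable_of_hasCompactSupport hcs.mul_right
  have hA : ∀ a ∈ Algebra.adjoin ℝ (S : Set C(X, ℝ)), ∫ x, h x * a x ∂μ = 0 := by
    intro a ha
    have ha' : a ∈ Submodule.span ℝ (S : Set C(X, ℝ)) := by
      have : a ∈ Subalgebra.toSubmodule (Algebra.adjoin ℝ (S : Set C(X, ℝ))) := ha
      rwa [Algebra.adjoin_eq_span, Submonoid.closure_eq] at this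
    clear ha
    induction ha' using Submodule.span_induction with
    | mem x hx => exact hS x hx
    | zero => simp
    | add x y _ _ hx hy =>
      simp only [ContinuousMap.add_apply, mul_add]
      rw [integral_add (hint x) (hint y), hx, hy, add_zero]
    | smul c x _ hx =>
      simp only [ContinuousMap.smul_apply, smul_eq_mul, mul_left_comm _ c]
      rw [integral_const_mul, hx, mul_zero]
  have hsepA : (Algebra.adjoin ℝ (S : Set C(X, ℝ))).SeparatesPoints := by
    intro x y hxy
    obtain ⟨f, hf, hfne⟩ := hsep x y hxy
    exact ⟨f, ⟨f, Algebra.subset_adjoin hf, rfl⟩, hfne⟩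
  by_contra hne
  obtain ⟨x, hx⟩ : ∃ x, h x ≠ 0 := by
    by_contra! H
    exact hne (funext H)
  have hpos : 0 < ∫ x, h x * h x ∂μ :=
    (hc.mul hc).integral_pos_of_hasCompactSupport_nonneg_nonzero hcs.mul_right
      (fun y => mul_self_nonneg _) (mul_ne_zero hx hx)
  have habs : Integrable (fun x => |h x|) μ :=
    (hc.integrable_of_hasCompactSupport hcs).abs
  set I := ∫ x, |h x| ∂μ with hI
  have hI0 : 0 ≤ I := integral_nonneg fun _ => abs_nonneg _
  set ε := (∫ x, h x * h x ∂μ) / (2 * (I + 1)) with hε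
  have hεpos : 0 < ε := by positivity
  obtain ⟨g, hg, hgε⟩ :=
    ContinuousMap.exists_mem_subalgebra_near_continuous_of_isCompact_of_separatesPoints
      hsepA ⟨h, hc⟩ hcs.isCompact hεpos
  have h1 : ∫ x, h x * h x ∂μ = ∫ x, (h x * h x - h x * g x) ∂μ := by
    have hh : Integrable (fun x => h x * h x) μ := hint ⟨h, hc⟩
    rw [integral_sub hh (hint g), hA g hg, sub_zero]
  have h2 : ∫ x, (h x * h x - h x * g x) ∂μ ≤ ∫ x, |h x| * ε ∂μ := by
    apply integral_mono ((hint ⟨h, hc⟩).sub (hint g)) (habs.mul_const _)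
    intro x
    by_cases hx : x ∈ tsupport h
    · have := (hgε x hx).le
      simp only [ContinuousMap.coe_mk, Real.norm_eq_abs] at this
      calc h x * h x - h x * g x ≤ |h x * h x - h x * g x| := le_abs_self _
        _ = |h x| * |g x - h x| := by rw [← mul_sub, abs_mul, abs_sub_comm]
        _ ≤ |h x| * ε := by gcongr
    · have : h x = 0 := image_eq_zero_of_notMem_tsupport hx
      simp [this]
  rw [integral_mul_const, ← hI] at h2
  have h3 : ε * (2 * (I + 1)) = ∫ x, h x * h x ∂μ := by
    rw [hε]; field_simp
  nlinarith

/-- one-dimensional uniqueness -/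
lemma laplace1 (g : ℝ → ℝ) (hc : Continuous g) (hcs : HasCompactSupport g)
    (h : ∀ n : ℕ, ∫ s, Real.exp ((n + 1 : ℝ) * s) * g s = 0) : g = 0 := by
  have key := sw_lemma volume (fun s => g s * Real.exp s) (by fun_prop) hcs.mul_right
    (Submonoid.powers (⟨Real.exp, by fun_prop⟩ : C(ℝ, ℝ)))
    (fun x y hxy => ⟨_, Submonoid.mem_powers _, by simpa using hxy⟩) (by
      rintro a ⟨n, rfl⟩
      rw [← h n]
      congr 1; ext s
      simp only [ContinuousMap.pow_apply, ContinuousMap.coe_mk]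
      rw [← Real.exp_nat_mul, add_mul, Real.exp_add, one_mul]; ring)
  ext s
  have := congrFun key s
  simpa [Real.exp_ne_zero] using this

/-- the bilateral Laplace transform on the plane -/
noncomputable def Lap (φ : ℝ × ℝ → ℝ) (q : ℝ × ℝ) : ℝ := ∫ x : ℝ × ℝ, φ x * Real.exp (q.1 * x.1 + q.2 * x.2)

lemma laplace2 (φ : ℝ × ℝ → ℝ) (hc : Continuous φ) (hcs : HasCompactSupport φ)
    (h : ∀ q, Lap φ q = 0) : φ = 0 := by
  let S : Submonoid C(ℝ × ℝ, ℝ) :=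
    { carrier := {f | ∃ q : ℝ × ℝ, ∀ x, f x = Real.exp (q.1 * x.1 + q.2 * x.2)}
      one_mem' := ⟨0, by simp⟩
      mul_mem' := by
        rintro a b ⟨p, hp⟩ ⟨q, hq⟩
        refine ⟨p + q, fun x => ?_⟩
        simp only [ContinuousMap.mul_apply, hp, hq, ← Real.exp_add, Prod.fst_add, Prod.snd_add]
        ring_nf }
  refine sw_lemma volume φ hc hcs S ?_ ?_
  · intro x y hxy
    by_cases h1 : x.1 = y.1
    · refine ⟨⟨fun x => Real.exp x.2, by fun_prop⟩, ⟨(0, 1), by simp⟩, ?_⟩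
      intro h2
      exact hxy (Prod.ext h1 (by simpa using h2))
    · exact ⟨⟨fun x => Real.exp x.1, by fun_prop⟩, ⟨(1, 0), by simp⟩, by simpa using h1⟩
  · rintro a ⟨q, hq⟩
    simp only [hq]
    exact h q

lemma supp_compact {M : ℝ} (hM : 0 < M) {φ : ℝ × ℝ → ℝ} (hs : SuppIn M φ) :
    HasCompactSupport φ := by
  refine HasCompactSupport.intro (K := Set.Icc (-M) M ×ˢ Set.Icc (-M) M)
    (isCompact_Icc.prod isCompact_Icc) ?_
  intro x hx
  apply hs
  by_contra! H
  apply hx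
  simp only [Set.mem_prod, Set.mem_Icc, ← abs_le]
  constructor
  · exact abs_le_of_sq_le_sq (by nlinarith [sq_nonneg x.2]) hM.le
  · exact abs_le_of_sq_le_sq (by nlinarith [sq_nonneg x.1]) hM.le

lemma Lap_cont {φ : ℝ × ℝ → ℝ} (hc : Continuous φ) (hcs : HasCompactSupport φ) :
    Continuous (Lap φ) := by
  have h := continuous_parametric_integral_of_continuous (μ := (volume : Measure (ℝ × ℝ)))
    (f := fun (q x : ℝ × ℝ) => φ x * Real.exp (q.1 * x.1 + q.2 * x.2))
    (by unfold Function.uncurry; fun_prop) hcs.isCompact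
  convert h using 2 with q
  unfold Lap
  rw [setIntegral_eq_integral_of_forall_compl_eq_zero]
  intro x hx
  simp [image_eq_zero_of_notMem_tsupport hx]

lemma integral_rot (θ : ℝ) (ψ : ℝ × ℝ → ℝ) :
    ∫ p : ℝ × ℝ, ψ (p.1 * Real.cos θ - p.2 * Real.sin θ, p.1 * Real.sin θ + p.2 * Real.cos θ)
      = ∫ p, ψ p := by
  have h1 := Complex.volume_preserving_equiv_real_prod
  have h2 := (rotation (Circle.exp θ)).measurePreserving
  have h3 := (h1.symm.trans (β := ℂ) (e' := (rotation (Circle.exp θ)).toMeasurableEquiv) h2).trans h1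
  rw [← h3.integral_comp (MeasurableEquiv.measurableEmbedding _) ψ]
  congr 1; ext p; congr 1
  ext <;> simp [Circle.coe_exp, Complex.exp_mul_I] <;>
    simp [Complex.cos_ofReal_re, Complex.sin_ofReal_re] <;> ring

lemma radon_supp {M : ℝ} {φ : ℝ × ℝ → ℝ} (hs : SuppIn M φ) (θ s t : ℝ) (h : M ^ 2 < s ^ 2 + t ^ 2) :
    φ (s * Real.cos θ - t * Real.sin θ, s * Real.sin θ + t * Real.cos θ) = 0 := by
  apply hs
  simp only
  nlinarith [Real.sin_sq_add_cos_sq θ, congrArg (fun z => (s^2+t^2) * z) (Real.sin_sq_add_cos_sq θ)]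

lemma sq_lt_of_notMem {M s : ℝ} (hM : 0 < M) (h : s ∉ Set.Icc (-M) M) : M ^ 2 < s ^ 2 := by
  rw [Set.mem_Icc, ← abs_le, not_le] at h
  rw [← sq_abs s]
  nlinarith

lemma radon_zero {M : ℝ} (hM : 0 < M) {φ : ℝ × ℝ → ℝ} (hs : SuppIn M φ) (θ s : ℝ)
    (h : s ∉ Set.Icc (-M) M) : radon φ s θ = 0 := by
  unfold radon
  have : ∀ t, φ (s * Real.cos θ - t * Real.sin θ, s * Real.sin θ + t * Real.cos θ) = 0 :=
    fun t => radon_supp hs θ s t (by nlinarith [sq_lt_of_notMem hM h, sq_nonneg t])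
  simp [this]

lemma radon_compact {M : ℝ} (hM : 0 < M) {φ : ℝ × ℝ → ℝ} (hs : SuppIn M φ) (θ : ℝ) :
    HasCompactSupport (fun s => radon φ s θ) :=
  HasCompactSupport.intro isCompact_Icc (fun s hs' => radon_zero hM hs θ s hs')

lemma radon_smooth {M : ℝ} (hM : 0 < M) {φ : ℝ × ℝ → ℝ} (hφ : ContDiff ℝ (⊤ : ℕ∞) φ)
    (hs : SuppIn M φ) (θ : ℝ) : ContDiff ℝ (⊤ : ℕ∞) (fun s => radon φ s θ) := by
  have h := contDiffOn_convolution_right_with_param (𝕜 := ℝ) (μ := (volume : Measure ℝ))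
    (f := fun _ : ℝ => (1 : ℝ)) (n := (⊤ : ℕ∞)) (ContinuousLinearMap.mul ℝ ℝ)
    (g := fun s t : ℝ => φ (s * Real.cos θ - t * Real.sin θ, s * Real.sin θ + t * Real.cos θ))
    (s := Set.univ) (k := Set.Icc (-M) M) isOpen_univ isCompact_Icc
    (fun s t _ ht => radon_supp hs θ s t (by nlinarith [sq_lt_of_notMem hM ht, sq_nonneg s]))
    (locallyIntegrable_const _)
    (by
      apply ContDiff.contDiffOn
      apply hφ.comp
      fun_prop)
  rw [Set.univ_prod_univ, contDiffOn_univ] at h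
  have h' := h.comp (g := _) (f := fun s : ℝ => (s, (0 : ℝ))) (by fun_prop)
  convert h' using 2 with s
  simp only [Function.comp, convolution, ContinuousLinearMap.mul_apply', one_mul]
  unfold radon
  exact (integral_sub_left_eq_self (fun t => φ (s * Real.cos θ - t * Real.sin θ, s * Real.sin θ + t * Real.cos θ)) volume 0).symm

lemma slice {M : ℝ} (hM : 0 < M) {φ : ℝ × ℝ → ℝ} (hφ : Continuous φ)
    (hs : SuppIn M φ) (θ l : ℝ) :
    ∫ s, radon φ s θ * Real.exp (l * s) = Lap φ (l * Real.cos θ, l * Real.sin θ) := by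
  unfold Lap
  rw [← integral_rot θ]
  have e1 : ∀ p : ℝ × ℝ, l * Real.cos θ * (p.1 * Real.cos θ - p.2 * Real.sin θ) +
      l * Real.sin θ * (p.1 * Real.sin θ + p.2 * Real.cos θ) = l * p.1 := by
    intro p
    linear_combination (l * p.1) * Real.sin_sq_add_cos_sq θ
  simp only [e1]
  have hs' : SuppIn M (fun p : ℝ × ℝ => φ (p.1 * Real.cos θ - p.2 * Real.sin θ, p.1 * Real.sin θ + p.2 * Real.cos θ)) :=
    fun x hx => radon_supp hs θ _ _ hx
  rw [Measure.volume_eq_prod, integral_prod]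
  · simp only [integral_mul_const]
    rfl
  · rw [← Measure.volume_eq_prod]
    exact Continuous.integrable_of_hasCompactSupport (by fun_prop) (supp_compact hM hs').mul_right

/-- the Abel kernel -/
noncomputable def abelK (t : ℝ) : ℝ := (Set.Iio (0 : ℝ)).indicator (fun t => 1 / Real.sqrt (-t)) t

lemma abelK_exp_integrable (l : ℝ) (hl : 0 < l) :
    Integrable (fun t => Real.exp (l * t) * abelK t) := by
  have h := integrableOn_rpow_mul_exp_neg_mul_rpow (p := 1) (s := -(1/2)) (b := l)
    (by norm_num) one_pos hl
  have h' := IntegrableOn.comp_neg_Iio (c := (0 : ℝ)) (by simpa using h)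
  rw [← integrable_indicator_iff measurableSet_Iio] at h'
  refine h'.congr (Eventually.of_forall fun t => ?_)
  unfold abelK
  by_cases ht : t < 0
  · simp only [Set.indicator, Set.mem_Iio, ht, if_true]
    rw [Real.sqrt_eq_rpow, one_div, ← Real.rpow_neg (by linarith)]
    simp [mul_comm]
  · simp [Set.indicator, ht]

lemma abelK_loc : LocallyIntegrable abelK := by
  have h := (abelK_exp_integrable 1 one_pos).locallyIntegrable
  rw [← locallyIntegrableOn_univ] at h ⊢
  have h2 := h.continuousOn_mul (g := fun t => Real.exp (-t)) (by fun_prop)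
    isOpen_univ.isLocallyClosed
  have h3 : (fun t => Real.exp (-t) * (Real.exp (1 * t) * abelK t)) = abelK := by
    ext t
    rw [← mul_assoc, ← Real.exp_add]
    simp
  rwa [h3] at h2

lemma abelK_pos (l : ℝ) (hl : 0 < l) : ∫ t, Real.exp (l * t) * abelK t ≠ 0 := by
  intro h
  have hn : 0 ≤ fun t => Real.exp (l * t) * abelK t := fun t =>
    mul_nonneg (Real.exp_pos _).le (Set.indicator_nonneg (fun _ _ => by positivity) _)
  rw [integral_eq_zero_iff_of_nonneg hn (abelK_exp_integrable l hl)] at h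
  have h2 : ∀ᵐ t ∂(volume : Measure ℝ), t ∉ Set.Iio (0 : ℝ) := by
    filter_upwards [h] with t ht hlt
    have hlt' : 0 < -t := by simpa using hlt
    have : 0 < abelK t := by
      unfold abelK
      rw [Set.indicator_of_mem hlt]
      positivity
    have := mul_pos (Real.exp_pos (l * t)) this
    simp only [Pi.zero_apply] at ht
    linarith
  have h3 : (volume : Measure ℝ) (Set.Iio 0) = 0 := measure_eq_zero_iff_ae_notMem.2 h2
  simp at h3

lemma abel_conv (g : ℝ → ℝ) (x : ℝ) :
    convolution abelK g (ContinuousLinearMap.mul ℝ ℝ) volume x =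
      ∫ s in Set.Ioi x, g s / Real.sqrt (s - x) := by
  simp only [convolution, ContinuousLinearMap.mul_apply']
  rw [← integral_indicator measurableSet_Ioi,
    ← integral_sub_left_eq_self (fun s => (Set.Ioi x).indicator (fun s => g s / Real.sqrt (s - x)) s) volume x]
  congr 1; ext t
  unfold abelK
  by_cases ht : t < 0
  · rw [Set.indicator_of_mem (by simpa using ht), Set.indicator_of_mem (by simp only [Set.mem_Ioi]; linarith)]
    rw [show x - t - x = -t by ring]; ring
  · rw [Set.indicator_of_notMem (by simpa using ht), Set.indicator_of_notMem (by simp only [Set.mem_Ioi]; linarith)]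
    ring

lemma abel_inj (g : ℝ → ℝ) (hc : Continuous g) (hcs : HasCompactSupport g)
    (h : ∀ x, ∫ s in Set.Ioi x, g s / Real.sqrt (s - x) = 0) : g = 0 := by
  refine laplace1 g hc hcs fun n => ?_
  set l : ℝ := n + 1 with hl
  have hl0 : 0 < l := by positivity
  have hg : Integrable (fun s => Real.exp (l * s) * g s) :=
    Continuous.integrable_of_hasCompactSupport (by fun_prop) hcs.mul_left
  have h1 := integral_convolution (𝕜 := ℝ) (μ := volume) (ν := volume)
    (ContinuousLinearMap.mul ℝ ℝ) (abelK_exp_integrable l hl0) hg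
  have h2 : ∀ x, convolution (fun t => Real.exp (l * t) * abelK t)
      (fun s => Real.exp (l * s) * g s) (ContinuousLinearMap.mul ℝ ℝ) volume x = 0 := by
    intro x
    have h3 := abel_conv g x
    rw [h x] at h3
    simp only [convolution, ContinuousLinearMap.mul_apply'] at h3 ⊢
    rw [← mul_zero (Real.exp (l * x)), ← h3, ← integral_const_mul]
    congr 1; ext t
    rw [show l * x = l * t + l * (x - t) by ring, Real.exp_add]; ring
  simp only [h2, integral_zero, ContinuousLinearMap.mul_apply'] at h1
  exact (mul_eq_zero.1 h1.symm).resolve_left (abelK_pos l hl0)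

/-- a function vanishing on the right with `f' f'' = 0` on the left is zero -/
lemma ode_zero (M : ℝ) (f : ℝ → ℝ) (hf : ContDiff ℝ (⊤ : ℕ∞) f) (h0 : ∀ x, M < x → f x = 0)
    (h : ∀ x, x < M → deriv f x = 0 ∨ deriv (deriv f) x = 0) : ∀ x, f x = 0 := by
  have h1 : ContDiff ℝ (⊤ : ℕ∞) (deriv f) := by
    have := (contDiff_infty_iff_deriv (𝕜 := ℝ) (f := f)).1 hf
    exact this.2
  have h2 : ContDiff ℝ (⊤ : ℕ∞) (deriv (deriv f)) := by
    have := (contDiff_infty_iff_deriv (𝕜 := ℝ) (f := deriv f)).1 h1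
    exact this.2
  have hd0 : ∀ x, M < x → deriv f x = 0 := by
    intro x hx
    have : f =ᶠ[𝓝 x] fun _ => 0 := by
      filter_upwards [Ioi_mem_nhds hx] with y hy using h0 y hy
    rw [this.deriv_eq]; simp
  have hprod : (fun x => deriv f x * deriv (deriv f) x) = fun _ => 0 := by
    refine Continuous.ext_on (dense_compl_singleton M) (h1.continuous.mul h2.continuous)
      continuous_const ?_
    intro x hx
    rcases lt_or_gt_of_ne (show x ≠ M from hx) with hx | hx
    · rcases h x hx with h | h <;> simp [h]
    · simp [hd0 x hx]
  have hdiff1 : Differentiable ℝ (deriv f) := h1.differentiable (by simp)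
  have hsq : ∀ x, deriv f x ^ 2 = 0 := by
    intro x
    have := is_const_of_deriv_eq_zero (f := fun x => deriv f x ^ 2) (hdiff1.pow 2) (by
      intro y
      have hy := congrFun hprod y
      have hy2 := ((hdiff1 y).hasDerivAt.pow 2).deriv
      rw [show (fun x => deriv f x ^ 2) = deriv f ^ 2 from rfl, hy2]
      simp only [Nat.cast_ofNat, Nat.add_one_sub_one, pow_one]
      linear_combination 2 * hy) x (M + 1)
    rw [this, hd0 (M + 1) (by linarith)]; simp
  intro x
  rw [is_const_of_deriv_eq_zero (hf.differentiable (by simp))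
    (fun y => by simpa using hsq y) x (M + 1)]
  exact h0 _ (by linarith)

/-- For fixed `θ` -/
lemma fixed_theta {M : ℝ} (hM : 0 < M) {φ0 φ1 : ℝ × ℝ → ℝ}
    (hφ0 : ContDiff ℝ (⊤ : ℕ∞) φ0) (hφ1 : ContDiff ℝ (⊤ : ℕ∞) φ1)
    (hs0 : SuppIn M φ0) (hs1 : SuppIn M φ1) (θ : ℝ)
    (h : ∀ σ, σ < M → deriv (fun σ' => F0 φ0 φ1 σ' θ) σ = 0 ∨
      deriv (fun σ' => deriv (fun σ'' => F0 φ0 φ1 σ'' θ) σ') σ = 0) (l : ℝ) :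
    Lap φ1 (l * Real.cos θ, l * Real.sin θ) + l * Lap φ0 (l * Real.cos θ, l * Real.sin θ) = 0 := by
  have hr0 := radon_smooth hM hφ0 hs0 θ
  have hr1 := radon_smooth hM hφ1 hs1 θ
  have hc0 := radon_compact hM hs0 θ
  have hc1 := radon_compact hM hs1 θ
  have hr0' : ContDiff ℝ (⊤ : ℕ∞) (deriv (fun s => radon φ0 s θ)) :=
    ((contDiff_infty_iff_deriv (𝕜 := ℝ)).1 hr0).2
  have hc0' := hc0.deriv
  set g : ℝ → ℝ := fun s => radon φ1 s θ - deriv (fun s' => radon φ0 s' θ) s with hg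
  have hgs : ContDiff ℝ (⊤ : ℕ∞) g := hr1.sub hr0'
  have hgc : HasCompactSupport g := hc1.sub hc0'
  have hgz : ∀ s, M < s → g s = 0 := by
    intro s hs
    have h1 : radon φ1 s θ = 0 := radon_zero hM hs1 θ s (fun h => by linarith [h.2])
    have h2 : (fun s' => radon φ0 s' θ) =ᶠ[𝓝 s] fun _ => 0 := by
      filter_upwards [Ioi_mem_nhds hs] with y hy
      exact radon_zero hM hs0 θ y (fun h => by linarith [h.2, show M < y from hy])
    simp [hg, h1, h2.deriv_eq]
  set c : ℝ := 1 / (2 * Real.pi * Real.sqrt 2) with hcdef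
  have hcne : c ≠ 0 := by positivity
  have hF : (fun σ => F0 φ0 φ1 σ θ) =
      fun σ => c * convolution abelK g (ContinuousLinearMap.mul ℝ ℝ) volume σ := by
    ext σ
    rw [abel_conv]; rfl
  have hFs : ContDiff ℝ (⊤ : ℕ∞) (fun σ => F0 φ0 φ1 σ θ) := by
    rw [hF]
    exact contDiff_const.mul (hgc.contDiff_convolution_right _ abelK_loc hgs)
  have hF0 : ∀ σ, F0 φ0 φ1 σ θ = 0 := by
    refine ode_zero M _ hFs ?_ h
    intro σ hσ
    have := congrFun hF σ
    rw [this, abel_conv, setIntegral_eq_zero_of_forall_eq_zero, mul_zero]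
    intro s hs
    rw [hgz s (lt_trans hσ hs), zero_div]
  have hg0 : g = 0 := by
    refine abel_inj g hgs.continuous hgc fun x => ?_
    have := congrFun hF x
    simp only [hF0, abel_conv] at this
    exact (mul_eq_zero.1 this.symm).resolve_left hcne
  have hder : ∀ s, deriv (fun s' => radon φ0 s' θ) s = radon φ1 s θ := by
    intro s
    have := congrFun hg0 s
    simp only [hg, Pi.zero_apply] at this
    linarith
  rw [← slice hM hφ1.continuous hs1, ← slice hM hφ0.continuous hs0, ← integral_const_mul,
    ← integral_add]
  · refine integral_eq_zero_of_hasDerivAt_of_integrable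
      (f := fun s => radon φ0 s θ * Real.exp (l * s)) ?_ ?_ ?_
    · intro s
      have h1 : HasDerivAt (fun s' => radon φ0 s' θ) (radon φ1 s θ) s := by
        rw [← hder]
        exact (hr0.differentiable (by simp) s).hasDerivAt
      have h2 : HasDerivAt (fun s => Real.exp (l * s)) (Real.exp (l * s) * l) s := by
        simpa using ((hasDerivAt_id s).const_mul l).exp
      have h3 := h1.mul h2
      rwa [show radon φ1 s θ * Real.exp (l * s) + radon φ0 s θ * (Real.exp (l * s) * l) =
        radon φ1 s θ * Real.exp (l * s) + l * (radon φ0 s θ * Real.exp (l * s)) by ring] at h3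
    · apply Continuous.integrable_of_hasCompactSupport
      · have := hr0.continuous
        have := hr1.continuous
        fun_prop
      · exact hc1.mul_right.add (hc0.mul_right.mul_left)
    · apply Continuous.integrable_of_hasCompactSupport
      · have := hr0.continuous
        fun_prop
      · exact hc0.mul_right
  · apply Continuous.integrable_of_hasCompactSupport
    · have := hr1.continuous
      fun_prop
    · exact hc1.mul_right
  · apply Continuous.integrable_of_hasCompactSupport
    · have := hr0.continuous
      fun_prop
    · exact hc0.mul_right.mul_left

lemma dense_ne_zero (P : ℝ → ℝ) (hP : AnalyticOnNhd ℝ P Set.univ) (hne : ∃ x, P x ≠ 0) :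
    Dense {x | P x ≠ 0} := by
  obtain ⟨x0, hx0⟩ := hne
  rw [← Set.compl_ofPred, ← interior_eq_empty_iff_dense_compl, Set.eq_empty_iff_forall_notMem]
  intro x hx
  apply hx0
  refine hP.eqOn_zero_of_preconnected_of_eventuallyEq_zero isPreconnected_univ
    (Set.mem_univ x) ?_ (Set.mem_univ x0)
  exact mem_interior_iff_mem_nhds.1 hx

lemma omegaHat_an (i : Fin 3) : AnalyticOnNhd ℝ (fun θ => omegaHat θ i) Set.univ := by
  fin_cases i
  · exact analyticOnNhd_const
  · exact Real.analyticOnNhd_cos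
  · exact Real.analyticOnNhd_sin

lemma quad_an (d : Fin 3 → Fin 3 → ℝ) : AnalyticOnNhd ℝ
    (fun θ => ∑ i : Fin 3, ∑ j : Fin 3, d i j * omegaHat θ i * omegaHat θ j) Set.univ := by
  refine Finset.analyticOnNhd_fun_sum _ fun i _ => Finset.analyticOnNhd_fun_sum _ fun j _ => ?_
  exact (analyticOnNhd_const.mul (omegaHat_an i)).mul (omegaHat_an j)

lemma cubic_an (e : Fin 3 → Fin 3 → Fin 3 → ℝ) : AnalyticOnNhd ℝ
    (fun θ => ∑ i : Fin 3, ∑ j : Fin 3, ∑ k : Fin 3,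
      e i j k * omegaHat θ i * omegaHat θ j * omegaHat θ k) Set.univ := by
  refine Finset.analyticOnNhd_fun_sum _ fun i _ => Finset.analyticOnNhd_fun_sum _ fun j _ =>
    Finset.analyticOnNhd_fun_sum _ fun k _ => ?_
  exact ((analyticOnNhd_const.mul (omegaHat_an i)).mul (omegaHat_an j)).mul (omegaHat_an k)

lemma quad_ne (d : Fin 3 → Fin 3 → ℝ)
    (hdsymm : ∀ i j, d i j = d j i) (hd00 : d 0 0 = 0)
    (hdne : ∃ i j : Fin 3, (i, j) ≠ ((0 : Fin 3), (0 : Fin 3)) ∧ d i j ≠ 0) :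
    ∃ θ, (∑ i : Fin 3, ∑ j : Fin 3, d i j * omegaHat θ i * omegaHat θ j) ≠ 0 := by
  by_contra! H
  have e01 := hdsymm 1 0
  have e02 := hdsymm 2 0
  have e12 := hdsymm 2 1
  have a1 := H 0
  have a2 := H Real.pi
  have a3 := H (Real.pi / 2)
  have a4 := H (-(Real.pi / 2))
  have a5 := H (Real.pi / 4)
  simp only [Fin.sum_univ_three, omegaHat, Matrix.cons_val_zero, Matrix.cons_val_one,
    Matrix.cons_val, Real.cos_zero, Real.sin_zero, Real.cos_pi, Real.sin_pi,
    Real.cos_pi_div_two, Real.sin_pi_div_two, Real.cos_neg, Real.sin_neg, e01, e02, e12, hd00]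
    at a1 a2 a3 a4 a5
  have b1 : d 0 1 = 0 := by linarith
  have b2 : d 0 2 = 0 := by linarith
  have b3 : d 1 1 = 0 := by linarith
  have b4 : d 2 2 = 0 := by linarith
  have b5 : d 1 2 = 0 := by
    simp only [b1, b2, b3, b4, Real.cos_pi_div_four, Real.sin_pi_div_four] at a5
    have : Real.sqrt 2 * Real.sqrt 2 = 2 := Real.mul_self_sqrt (by norm_num)
    linear_combination a5 - d 1 2 / 2 * this
  obtain ⟨i, j, -, hij⟩ := hdne
  have b6 : d 1 0 = 0 := e01.trans b1
  have b7 : d 2 0 = 0 := e02.trans b2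
  have b8 : d 2 1 = 0 := e12.trans b5
  apply hij
  fin_cases i <;> fin_cases j <;> assumption

lemma cubic_ne (e : Fin 3 → Fin 3 → Fin 3 → ℝ) (h : NullCondFails e) :
    ∃ θ, (∑ i : Fin 3, ∑ j : Fin 3, ∑ k : Fin 3,
      e i j k * omegaHat θ i * omegaHat θ j * omegaHat θ k) ≠ 0 := by
  obtain ⟨ξ, h1, h2, h3⟩ := h
  have h0 : ξ 0 ≠ 0 := by
    intro h0
    rw [h0] at h1
    rcases h2 with h2 | h2 <;> have := sq_pos_of_ne_zero h2 <;>
      nlinarith [sq_nonneg (ξ 1), sq_nonneg (ξ 2)]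
  obtain ⟨θ, hc, hs⟩ : ∃ θ, Real.cos θ = -ξ 1 / ξ 0 ∧ Real.sin θ = -ξ 2 / ξ 0 := by
    set z : ℂ := ⟨-ξ 1 / ξ 0, -ξ 2 / ξ 0⟩ with hz
    have hn : ‖z‖ = 1 := by
      have : ‖z‖ ^ 2 = 1 := by
        rw [Complex.sq_norm, Complex.normSq_mk]
        field_simp
        linarith
      nlinarith [norm_nonneg z]
    refine ⟨z.arg, ?_, ?_⟩
    · have := Complex.norm_mul_cos_arg z
      rwa [hn, one_mul] at this
    · have := Complex.norm_mul_sin_arg z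
      rwa [hn, one_mul] at this
  have hω : ∀ i, ξ i = -ξ 0 * omegaHat θ i := by
    intro i
    fin_cases i <;> simp [omegaHat, hc, hs] <;> field_simp
  refine ⟨θ, fun H => h3 ?_⟩
  have : (∑ i : Fin 3, ∑ j : Fin 3, ∑ k : Fin 3, e i j k * ξ i * ξ j * ξ k) =
      (-ξ 0) ^ 3 * ∑ i : Fin 3, ∑ j : Fin 3, ∑ k : Fin 3,
      e i j k * omegaHat θ i * omegaHat θ j * omegaHat θ k := by
    simp only [Finset.mul_sum]
    refine Finset.sum_congr rfl fun i _ => Finset.sum_congr rfl fun j _ =>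
      Finset.sum_congr rfl fun k _ => ?_
    rw [hω i, hω j, hω k]
    have := hω 0
    simp only [omegaHat, Matrix.cons_val_zero] at this
    ring
  rw [this, H, mul_zero]

lemma F_congr {θ θ' : ℝ} (hc : Real.cos θ = Real.cos θ') (hs : Real.sin θ = Real.sin θ')
    (d : Fin 3 → Fin 3 → ℝ) (e : Fin 3 → Fin 3 → Fin 3 → ℝ) (φ0 φ1 : ℝ × ℝ → ℝ) (σ : ℝ) :
    F1 d φ0 φ1 σ θ = F1 d φ0 φ1 σ θ' ∧ F2 e φ0 φ1 σ θ = F2 e φ0 φ1 σ θ' := by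
  simp only [F1, F2, F0, radon, omegaHat, hc, hs, and_self]

/-- Step 2 in the proof of Lemma 2.1: the set
`D₁ = {(σ,θ) ∈ (−∞,M)×[0,2π] : F₁(σ,θ) ≠ 0, F₂(σ,θ) ≠ 0}` is nonempty. -/
theorem F1_F2_ne_set_nonempty
    (M : ℝ) (hM : 0 < M)
    (φ0 φ1 : ℝ × ℝ → ℝ)
    (hφ0 : ContDiff ℝ (⊤ : ℕ∞) φ0) (hφ1 : ContDiff ℝ (⊤ : ℕ∞) φ1)
    (hs0 : SuppIn M φ0) (hs1 : SuppIn M φ1)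
    (d : Fin 3 → Fin 3 → ℝ)
    (hdsymm : ∀ i j, d i j = d j i) (hd00 : d 0 0 = 0)
    (hdne : ∃ i j : Fin 3, (i, j) ≠ ((0 : Fin 3), (0 : Fin 3)) ∧ d i j ≠ 0)
    (e : Fin 3 → Fin 3 → Fin 3 → ℝ)
    (hnull : NullCondFails e)
    (hne : φ0 ≠ 0 ∨ φ1 ≠ 0) :
    ∃ p : ℝ × ℝ, p.1 < M ∧ p.2 ∈ Set.Icc 0 (2 * Real.pi) ∧
      F1 d φ0 φ1 p.1 p.2 ≠ 0 ∧ F2 e φ0 φ1 p.1 p.2 ≠ 0 := by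
  by_contra! H
  have H' : ∀ σ θ, σ < M → F1 d φ0 φ1 σ θ = 0 ∨ F2 e φ0 φ1 σ θ = 0 := by
    intro σ θ hσ
    set θ' := toIcoMod Real.two_pi_pos 0 θ with hθ'
    have hmem : θ' ∈ Set.Icc 0 (2 * Real.pi) := by
      have := toIcoMod_mem_Ico Real.two_pi_pos 0 θ
      rw [zero_add] at this
      exact ⟨this.1, this.2.le⟩
    have hco : Real.cos θ = Real.cos θ' := by
      rw [hθ', toIcoMod, zsmul_eq_mul, Real.cos_sub_int_mul_two_pi]
    have hsi : Real.sin θ = Real.sin θ' := by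
      rw [hθ', toIcoMod, zsmul_eq_mul, Real.sin_sub_int_mul_two_pi]
    obtain ⟨h1, h2⟩ := F_congr hco hsi d e φ0 φ1 σ
    rw [h1, h2]
    by_cases hF : F1 d φ0 φ1 σ θ' = 0
    · exact Or.inl hF
    · exact Or.inr (H (σ, θ') hσ hmem hF)
  have hk0 := supp_compact hM hs0
  have hk1 := supp_compact hM hs1
  have hL0 := Lap_cont hφ0.continuous hk0
  have hL1 := Lap_cont hφ1.continuous hk1
  have hdP := dense_ne_zero _ (quad_an d) (quad_ne d hdsymm hd00 hdne)
  have hdQ := dense_ne_zero _ (cubic_an e) (cubic_ne e hnull)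
  have hdense := hdP.inter_of_isOpen_left hdQ
    (isOpen_ne_fun (continuousOn_univ.1 (quad_an d).continuousOn) continuous_const)
  have hall : ∀ l θ, Lap φ1 (l * Real.cos θ, l * Real.sin θ) +
      l * Lap φ0 (l * Real.cos θ, l * Real.sin θ) = 0 := by
    intro l
    refine congrFun (Continuous.ext_on hdense (f := fun θ =>
      Lap φ1 (l * Real.cos θ, l * Real.sin θ) +
      l * Lap φ0 (l * Real.cos θ, l * Real.sin θ)) (g := fun _ => 0)
      (by fun_prop) continuous_const ?_)
    rintro θ ⟨hP, hQ⟩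
    refine fixed_theta hM hφ0 hφ1 hs0 hs1 θ (fun σ hσ => ?_) l
    rcases H' σ θ hσ with h | h
    · exact Or.inl ((mul_eq_zero.1 h).resolve_left hP)
    · exact Or.inr ((mul_eq_zero.1 h).resolve_left hQ)
  have hall2 : ∀ l θ, Lap φ1 (l * Real.cos θ, l * Real.sin θ) -
      l * Lap φ0 (l * Real.cos θ, l * Real.sin θ) = 0 := by
    intro l θ
    have := hall (-l) (θ + Real.pi)
    rw [Real.cos_add_pi, Real.sin_add_pi, neg_mul_neg, neg_mul_neg] at this
    linarith
  have hpol : ∀ q : ℝ × ℝ, ∃ l θ, q = (l * Real.cos θ, l * Real.sin θ) ∧ (q ≠ 0 → l ≠ 0) := by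
    intro q
    refine ⟨‖(⟨q.1, q.2⟩ : ℂ)‖, Complex.arg ⟨q.1, q.2⟩, ?_, ?_⟩
    · rw [Complex.norm_mul_cos_arg, Complex.norm_mul_sin_arg]
    · intro hq h
      rw [norm_eq_zero, Complex.ext_iff] at h
      exact hq (Prod.ext h.1 h.2)
  have hz1 : ∀ q, Lap φ1 q = 0 := by
    intro q
    obtain ⟨l, θ, rfl, -⟩ := hpol q
    linarith [hall l θ, hall2 l θ]
  have hz0 : Lap φ0 = fun _ => 0 := by
    refine Continuous.ext_on (dense_compl_singleton (0 : ℝ × ℝ)) hL0 continuous_const ?_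
    intro q hq
    obtain ⟨l, θ, rfl, hl⟩ := hpol q
    have h1 : l * Lap φ0 (l * Real.cos θ, l * Real.sin θ) = 0 := by
      linarith [hall l θ, hall2 l θ]
    exact (mul_eq_zero.1 h1).resolve_left (hl hq)
  rcases hne with h | h
  · exact h (laplace2 φ0 hφ0.continuous hk0 (fun q => congrFun hz0 q))
  · exact h (laplace2 φ1 hφ1.continuous hk1 hz1)
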